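/- arXiv:2406.03942 — 3 statements merged into one kernel-verified Lean document; each statement's English description precedes it below -/
import Mathlib

section
/- Let S be a finite generalized quadrangle of order (s,t) with s,t ≥ 1, and let Ω be its set of flags. For every pair of flags (x,y) ∈ R_3: N_{35}(x,y)=t(s−1), N_{56}(x,y)=st, and N_{33}(x,y)=N_{36}(x,y)=N_{44}(x,y)=N_{45}(x,y)=N_{55}(x,y)=N_{65}(x,y)=0. -/
section Defs

variable {P L : Type*}

/-- Two distinct points are collinear if some line is incident with both. -/
def Collin (I : P → L → Prop) (p q : P) : Prop :=
  p ≠ q ∧ ∃ N : L, I p N ∧ I q N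

/-- A finite generalized quadrangle of order `(s,t)` with point set `P`,
line set `L` and incidence relation `I`. -/
structure IsGQ (s t : ℕ) (P L : Type*) (I : P → L → Prop) : Prop where
  nonemptyP : Nonempty P
  nonemptyL : Nonempty L
  finP : Finite P
  finL : Finite L
  lines_through : ∀ p : P, Nat.card {l : L // I p l} = t + 1
  points_on : ∀ l : L, Nat.card {p : P // I p l} = s + 1
  unique_line : ∀ p q : P, p ≠ q → ∀ l m : L, I p l → I q l → I p m → I q m → l = m
  unique_point : ∀ l m : L, l ≠ m → ∀ p q : P, I p l → I p m → I q l → I q m → p = q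
  gq3 : ∀ (p : P) (l : L), ¬ I p l →
    ∃! qM : P × L, I p qM.2 ∧ I qM.1 qM.2 ∧ I qM.1 l

/-- The set of flags (incident point–line pairs). -/
def GQFlag (I : P → L → Prop) : Type _ := {x : P × L // I x.1 x.2}

/-- The relations `R_0, …, R_7` on the set of flags.  For a flag `x = (p,L)` and
a flag `y = (q,M)`:
`R_0`: the diagonal; `R_1`: `p = q`, `L ≠ M`; `R_2`: `L = M`, `p ≠ q`;
`R_3`: `p ≠ q`, `L ≠ M`, `q` incident with `L`;
`R_4`: `p ≠ q`, `L ≠ M`, `p` incident with `M`;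
`R_5`: `p ≠ q` collinear on a line different from both `L` and `M`;
`R_6`: `L ≠ M` meet in a point `r` with `r ≠ p`, `r ≠ q`;
`R_7`: `L` and `M` have no common point and `p`, `q` are not collinear. -/
def Rrel (I : P → L → Prop) : ℕ → GQFlag I → GQFlag I → Prop
  | 0 => fun x y => x = y
  | 1 => fun x y => x.1.1 = y.1.1 ∧ x.1.2 ≠ y.1.2
  | 2 => fun x y => x.1.2 = y.1.2 ∧ x.1.1 ≠ y.1.1
  | 3 => fun x y => x.1.1 ≠ y.1.1 ∧ x.1.2 ≠ y.1.2 ∧ I y.1.1 x.1.2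
  | 4 => fun x y => x.1.1 ≠ y.1.1 ∧ x.1.2 ≠ y.1.2 ∧ I x.1.1 y.1.2
  | 5 => fun x y => x.1.1 ≠ y.1.1 ∧ ∃ N : L, I x.1.1 N ∧ I y.1.1 N ∧ N ≠ x.1.2 ∧ N ≠ y.1.2
  | 6 => fun x y => x.1.2 ≠ y.1.2 ∧ ∃ r : P, I r x.1.2 ∧ I r y.1.2 ∧ r ≠ x.1.1 ∧ r ≠ y.1.1
  | 7 => fun x y => (∀ r : P, ¬ (I r x.1.2 ∧ I r y.1.2)) ∧ ¬ Collin I x.1.1 y.1.1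
  | _ => fun _ _ => False

/-- `Ncount I i j x y` is the number of flags `z` with `(x,z) ∈ R_i` and `(z,y) ∈ R_j`. -/
noncomputable def Ncount (I : P → L → Prop) (i j : ℕ) (x y : GQFlag I) : ℕ :=
  Nat.card {z : GQFlag I // Rrel I i x z ∧ Rrel I j z y}

/-- The fused relations `S_0 = R_0`, `S_1 = R_1 ∪ R_2`, `S_2 = R_3 ∪ R_4`,
`S_3 = R_5 ∪ R_6`, `S_4 = R_7`. -/
def Srel (I : P → L → Prop) : ℕ → GQFlag I → GQFlag I → Prop
  | 0 => fun x y => Rrel I 0 x y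
  | 1 => fun x y => Rrel I 1 x y ∨ Rrel I 2 x y
  | 2 => fun x y => Rrel I 3 x y ∨ Rrel I 4 x y
  | 3 => fun x y => Rrel I 5 x y ∨ Rrel I 6 x y
  | 4 => fun x y => Rrel I 7 x y
  | _ => fun _ _ => False

/-- `Mcount I i j x y` is the number of flags `z` with `(x,z) ∈ S_i` and `(z,y) ∈ S_j`. -/
noncomputable def Mcount (I : P → L → Prop) (i j : ℕ) (x y : GQFlag I) : ℕ :=
  Nat.card {z : GQFlag I // Srel I i x z ∧ Srel I j z y}

end Defs

/-- `C` is a maximal clique of the graph with adjacency relation `rel`. -/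
def IsMaxClique {α : Type*} (rel : α → α → Prop) (C : Set α) : Prop :=
  (∀ y ∈ C, ∀ z ∈ C, y ≠ z → rel y z) ∧
  ∀ D : Set α, C ⊆ D → (∀ y ∈ D, ∀ z ∈ D, y ≠ z → rel y z) → D = C

/-- The point-clique through `x`: `{x} ∪ {z | (x,z) ∈ R_1}`. -/
def PC {α : Type*} (rel : ℕ → α → α → Prop) (x : α) : Set α :=
  insert x {z | rel 1 x z}

/-- The line-clique through `x`: `{x} ∪ {z | (x,z) ∈ R_2}`. -/
def LC {α : Type*} (rel : ℕ → α → α → Prop) (x : α) : Set α :=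
  insert x {z | rel 2 x z}

section Helpers

variable {s t : ℕ} {P L : Type*} {I : P → L → Prop}

/-- A generalized quadrangle contains no triangles: the projection of a point to a line is unique. -/
lemma IsGQ.proj_unique (h : IsGQ s t P L I) {p a b : P} {l m n : L} (hp : ¬ I p l)
    (hpm : I p m) (ham : I a m) (hal : I a l) (hpn : I p n) (hbn : I b n) (hbl : I b l) :
    a = b ∧ m = n := by
  simpa using (h.gq3 p l hp).unique (y₁ := (a, m)) (y₂ := (b, n)) ⟨hpm, ham, hal⟩ ⟨hpn, hbn, hbl⟩

lemma IsGQ.card_lines_through_ne (h : IsGQ s t P L I) {p : P} {m : L} (hm : I p m) :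
    Nat.card {l : L // I p l ∧ l ≠ m} = t := by
  have := h.finL
  have h1 : Set.ncard {l | I p l} = t + 1 := h.lines_through p
  have h2 : {l : L | I p l ∧ l ≠ m} = {l | I p l} \ {m} := by ext; simp
  change Set.ncard {l : L | I p l ∧ l ≠ m} = t
  rw [h2, Set.ncard_sdiff_singleton_of_mem (s := {l | I p l}) hm, h1, Nat.add_sub_cancel]

/-- The number of flags whose point lies in a given set of points of a line `m` and whose line
differs from `m`. -/
lemma IsGQ.card_flags_ne (h : IsGQ s t P L I) (m : L) (A : Set P) (hA : ∀ p ∈ A, I p m) :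
    Nat.card {z : GQFlag I // z.1.1 ∈ A ∧ z.1.2 ≠ m} = A.ncard * t := by
  have := h.finP
  have := h.finL
  let e : {z : GQFlag I // z.1.1 ∈ A ∧ z.1.2 ≠ m} ≃ Σ p : A, {l : L // I p l ∧ l ≠ m} :=
    { toFun := fun z => ⟨⟨z.1.1.1, z.2.1⟩, ⟨z.1.1.2, z.1.2, z.2.2⟩⟩
      invFun := fun w => ⟨⟨(w.1.1, w.2.1), w.2.2.1⟩, w.1.2, w.2.2.2⟩
      left_inv := fun _ => rfl
      right_inv := fun _ => rfl }
  have := Fintype.ofFinite A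
  rw [Nat.card_congr e, Nat.card_sigma,
    Finset.sum_congr rfl fun (p : A) _ => h.card_lines_through_ne (hA p p.2)]
  rw [Finset.sum_const, smul_eq_mul, Finset.card_univ, ← Nat.card_eq_fintype_card,
    Nat.card_coe_set_eq]

lemma Ncount_eq_zero {i j : ℕ} {x y : GQFlag I}
    (h : ∀ z : GQFlag I, Rrel I i x z → Rrel I j z y → False) : Ncount I i j x y = 0 := by
  have : IsEmpty {z : GQFlag I // Rrel I i x z ∧ Rrel I j z y} := ⟨fun z => h z.1 z.2.1 z.2.2⟩
  exact Nat.card_of_isEmpty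

lemma IsGQ.Ncount_three_five (h : IsGQ s t P L I) {x y : GQFlag I} (hxy : Rrel I 3 x y) :
    Ncount I 3 5 x y = t * (s - 1) := by
  obtain ⟨⟨p, l⟩, hpl⟩ := x
  obtain ⟨⟨q, m⟩, hqm⟩ := y
  obtain ⟨hpq, hlm, hql⟩ := hxy
  dsimp only at hpl hqm hpq hlm hql
  have := h.finP
  have hcard : Set.ncard ({r | I r l} \ {p, q}) = s - 1 := by
    have h1 : Set.ncard {r | I r l} = s + 1 := h.points_on l
    rw [Set.ncard_sdiff (by rintro r (rfl | rfl) <;> assumption), h1, Set.ncard_pair hpq]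
    omega
  rw [mul_comm, ← hcard, ← h.card_flags_ne l _ fun r hr => hr.1]
  refine Nat.card_congr (Equiv.subtypeEquivRight ?_)
  rintro ⟨⟨r, k⟩, hrk⟩
  dsimp only at hrk
  simp only [Rrel, Set.mem_sdiff, Set.mem_ofPred_eq, Set.mem_insert_iff, Set.mem_singleton_iff]
  constructor
  · rintro ⟨⟨hpr, hlk, hrl⟩, hrq, -⟩
    exact ⟨⟨hrl, by rintro (rfl | rfl) <;> contradiction⟩, hlk.symm⟩
  · rintro ⟨⟨hrl, hr⟩, hkl⟩
    exact ⟨⟨fun e => hr (.inl e.symm), hkl.symm, hrl⟩, fun e => hr (.inr e),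
      l, hrl, hql, hkl.symm, hlm⟩

lemma IsGQ.Ncount_five_six (h : IsGQ s t P L I) {x y : GQFlag I} (hxy : Rrel I 3 x y) :
    Ncount I 5 6 x y = s * t := by
  obtain ⟨⟨p, l⟩, hpl⟩ := x
  obtain ⟨⟨q, m⟩, hqm⟩ := y
  obtain ⟨hpq, hlm, hql⟩ := hxy
  dsimp only at hpl hqm hpq hlm hql
  have := h.finP
  have hpm : ¬ I p m := fun hpm => hlm (h.unique_line p q hpq _ _ hpl hql hpm hqm)
  have hcard : Set.ncard ({u | I u m} \ {q}) = s := by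
    have h1 : Set.ncard {u | I u m} = s + 1 := h.points_on m
    rw [Set.ncard_sdiff_singleton_of_mem (s := {u | I u m}) hqm, h1, Nat.add_sub_cancel]
  conv_rhs => rw [← hcard, ← h.card_flags_ne m _ fun u hu => hu.1]
  have meet (z : {z : GQFlag I // Rrel I 5 ⟨(p, l), hpl⟩ z ∧ Rrel I 6 z ⟨(q, m), hqm⟩}) :
      ∃ u, I u z.1.1.2 ∧ I u m ∧ u ≠ z.1.1.1 ∧ u ≠ q := z.2.2.2
  choose f hf using meet
  refine Nat.card_eq_of_bijective
    (fun z => ⟨⟨(f z, z.1.1.2), (hf z).1⟩, ⟨(hf z).2.1, (hf z).2.2.2⟩, z.2.2.1⟩) ⟨?_, ?_⟩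
  · rintro ⟨⟨⟨r, k⟩, hrk⟩, h5, h6⟩ ⟨⟨⟨r', k'⟩, hrk'⟩, h5', h6'⟩ e
    obtain rfl : k = k' := congrArg (fun w => w.1.1.2) e
    obtain ⟨hpr, n, hpn, hrn, -, hnk⟩ := h5
    obtain ⟨-, n', hpn', hrn', -, -⟩ := h5'
    dsimp only at hrk hrk' hpr hpn hrn hnk hpn' hrn'
    have hpk : ¬ I p k := fun hpk => hnk (h.unique_line p r hpr _ _ hpn hrn hpk hrk)
    obtain rfl := (h.proj_unique hpk hpn hrn hrk hpn' hrn' hrk').1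
    rfl
  · rintro ⟨⟨⟨u, k⟩, huk⟩, ⟨hum, huq⟩, hkm⟩
    dsimp only at huk hum huq hkm
    change u ≠ q at huq
    have hul : ¬ I u l := fun hul => hlm (h.unique_line u q huq _ _ hul hql hum hqm)
    have hpk : ¬ I p k := fun hpk => huq (h.proj_unique hpm hpk huk hum hpl hql hqm).1
    obtain ⟨⟨r, n⟩, ⟨hpn, hrn, hrk⟩, -⟩ := h.gq3 p k hpk
    dsimp only at hpn hrn hrk
    have hnl : n ≠ l := by
      rintro rfl
      exact hkm (h.proj_unique hul huk hrk hrn hum hqm hql).2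
    have hur : u ≠ r := by
      rintro rfl
      exact huq (h.proj_unique hpm hpn hrn hum hpl hql hqm).1
    have h5 : Rrel I 5 ⟨(p, l), hpl⟩ ⟨(r, k), hrk⟩ :=
      ⟨fun (e : p = r) => hpk (e ▸ hrk), n, hpn, hrn, hnl, fun (e : n = k) => hpk (e ▸ hpn)⟩
    have h6 : Rrel I 6 ⟨(r, k), hrk⟩ ⟨(q, m), hqm⟩ := ⟨hkm, u, huk, hum, hur, huq⟩
    refine ⟨⟨⟨(r, k), hrk⟩, h5, h6⟩, Subtype.ext (Subtype.ext (Prod.ext ?_ rfl))⟩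
    have := hf ⟨⟨(r, k), hrk⟩, h5, h6⟩
    exact h.unique_point k m hkm _ _ this.1 this.2.1 huk hum

end Helpers

/-- the intersection numbers `N_{ij}` on pairs in `R_3`. -/
theorem stmt_3 {s t : ℕ} (hs : 1 ≤ s) (ht : 1 ≤ t)
    {P L : Type*} (I : P → L → Prop) (hGQ : IsGQ s t P L I) :
    ∀ x y : GQFlag I, Rrel I 3 x y →
      Ncount I 3 5 x y = t * (s - 1) ∧
      Ncount I 5 6 x y = s * t ∧
      Ncount I 3 3 x y = 0 ∧
      Ncount I 3 6 x y = 0 ∧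
      Ncount I 4 4 x y = 0 ∧
      Ncount I 4 5 x y = 0 ∧
      Ncount I 5 5 x y = 0 ∧
      Ncount I 6 5 x y = 0 := by
  rintro x y hxy
  refine ⟨hGQ.Ncount_three_five hxy, hGQ.Ncount_five_six hxy, ?_⟩
  obtain ⟨⟨p, l⟩, hpl⟩ := x
  obtain ⟨⟨q, m⟩, hqm⟩ := y
  obtain ⟨hpq, hlm, hql⟩ := hxy
  dsimp only at hpl hqm hpq hlm hql
  have hpm : ¬ I p m := fun hpm => hlm (hGQ.unique_line p q hpq _ _ hpl hql hpm hqm)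
  refine ⟨?_, ?_, ?_, ?_, ?_, ?_⟩ <;> refine Ncount_eq_zero ?_ <;> rintro ⟨⟨r, k⟩, hrk⟩ <;>
    dsimp only [Rrel] at hrk ⊢
  · rintro ⟨-, hlk, hrl⟩ ⟨hrq, -, hqk⟩
    exact hlk (hGQ.unique_line r q hrq _ _ hrl hql hrk hqk)
  · rintro ⟨-, hlk, hrl⟩ ⟨hkm, u, huk, hum, hur, huq⟩
    have hul : ¬ I u l := fun hul => hlm (hGQ.unique_line u q huq _ _ hul hql hum hqm)
    exact hkm (hGQ.proj_unique hul huk hrk hrl hum hqm hql).2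
  · rintro ⟨-, -, hpk⟩ ⟨hrq, -, hrm⟩
    exact hrq (hGQ.proj_unique hpm hpk hrk hrm hpl hql hqm).1
  · rintro ⟨hpr, hlk, hpk⟩ ⟨-, n, hrn, hqn, -, -⟩
    have hqk : ¬ I q k := fun hqk => hlk (hGQ.unique_line p q hpq _ _ hpl hql hpk hqk)
    exact hpr (hGQ.proj_unique hqk hql hpl hpk hqn hrn hrk).1
  · rintro ⟨hpr, n, hpn, hrn, hnl, -⟩ ⟨-, n', hrn', hqn', -, -⟩
    have hrl : ¬ I r l := fun hrl => hnl (hGQ.unique_line p r hpr _ _ hpn hrn hpl hrl)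
    exact hpq (hGQ.proj_unique hrl hrn hpn hpl hrn' hqn' hql).1
  · rintro ⟨hlk, u, hul, huk, -, hur⟩ ⟨-, n, hrn, hqn, hnk, -⟩
    have hrl : ¬ I r l := fun hrl => hlk (hGQ.unique_line u r hur _ _ hul hrl huk hrk)
    exact hnk (hGQ.proj_unique hrl hrn hqn hql hrk huk hul).2
end

section
/- Let S be a finite generalized quadrangle of order (s,t) with s,t ≥ 1, and let Ω be its set of flags. For every pair of flags (x,y) ∈ R_5: N_{55}(x,y)=t(s−1) and N_{56}(x,y)=s(t−1). -/
theorem Nat.card_subtype_and_ne {α : Type*} [Finite α] {Q : α → Prop} {a : α} {n : ℕ}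
    (ha : Q a) (h : Nat.card {x // Q x} = n + 1) :
    Nat.card {x // Q x ∧ x ≠ a} = n := by
  have h₁ : ({x | Q x} : Set α).ncard = n + 1 := h
  have h₂ := Set.ncard_sdiff_singleton_add_one (s := {x | Q x}) ha (Set.toFinite _)
  have h₃ : ({x | Q x} : Set α) \ {a} = {x | Q x ∧ x ≠ a} := by
    ext
    simp
  rw [h₃, h₁] at h₂
  exact Nat.succ_injective h₂

namespace IsGQ

variable {s t : ℕ} {P L : Type*} {I : P → L → Prop}

/-- The projection of a point on a line not incident with it is unique. -/
theorem proj_unique_s4 (h : IsGQ s t P L I) {p : P} {l : L} (hp : ¬ I p l) {q r : P} {m n : L}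
    (hpm : I p m) (hqm : I q m) (hq : I q l) (hpn : I p n) (hrn : I r n) (hr : I r l) :
    q = r ∧ m = n :=
  Prod.ext_iff.1 <| (h.gq3 p l hp).unique (y₁ := (q, m)) (y₂ := (r, n))
    ⟨hpm, hqm, hq⟩ ⟨hpn, hrn, hr⟩

/-- A generalized quadrangle has no triangles: a point collinear with two distinct points of a
line lies on that line. -/
theorem incident_of_collinear (h : IsGQ s t P L I) {p q r : P} {l m n : L} (hpq : p ≠ q)
    (hp : I p l) (hq : I q l) (hpm : I p m) (hrm : I r m) (hqn : I q n) (hrn : I r n) :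
    I r l := by
  by_contra hr
  exact hpq (h.proj_unique_s4 hr hrm hpm hp hrn hqn hq).1

theorem ncount_five_five (h : IsGQ (s + 1) t P L I) {x y : GQFlag I} (hxy : Rrel I 5 x y) :
    Ncount I 5 5 x y = t * s := by
  have := h.finP
  have := h.finL
  obtain ⟨⟨⟨p, A⟩, hA⟩, ⟨⟨q, B⟩, hB⟩⟩ := x, y
  obtain ⟨hpq, N, hpN, hqN, hNA, hNB⟩ := hxy
  dsimp only at hA hB hpq hpN hqN hNA hNB
  let F : (Σ r : {r // (I r N ∧ r ≠ p) ∧ r ≠ q}, {C // I r.1 C ∧ C ≠ N}) →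
      {z : GQFlag I // Rrel I 5 ⟨(p, A), hA⟩ z ∧ Rrel I 5 z ⟨(q, B), hB⟩} := fun w =>
    ⟨⟨(w.1.1, w.2.1), w.2.2.1⟩,
      ⟨w.1.2.1.2.symm, N, hpN, w.1.2.1.1, hNA, w.2.2.2.symm⟩,
      ⟨w.1.2.2, N, w.1.2.1.1, hqN, w.2.2.2.symm, hNB⟩⟩
  have hF : Function.Bijective F := by
    constructor
    · rintro ⟨⟨r, hr⟩, ⟨C, hC⟩⟩ ⟨⟨r', hr'⟩, ⟨C', hC'⟩⟩ he
      have he' : (r, C) = (r', C') := congrArg (fun z => z.1.1) he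
      obtain ⟨rfl, rfl⟩ := Prod.ext_iff.1 he'
      rfl
    · rintro ⟨⟨⟨r, C⟩, hC⟩, ⟨hpr, K, hpK, hrK, -, hKC⟩, ⟨hrq, M, hrM, hqM, -, -⟩⟩
      dsimp only at hC hpr hpK hrK hKC hrq hrM hqM
      have hrN : I r N := h.incident_of_collinear hpq hpN hqN hpK hrK hqM hrM
      have hKN : K = N := h.unique_line p r hpr K N hpK hrK hpN hrN
      exact ⟨⟨⟨r, ⟨hrN, hpr.symm⟩, hrq⟩, ⟨C, hC, fun e => hKC (hKN.trans e.symm)⟩⟩, rfl⟩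
  have hlines (r : {r // (I r N ∧ r ≠ p) ∧ r ≠ q}) : Nat.card {C // I r.1 C ∧ C ≠ N} = t :=
    Nat.card_subtype_and_ne r.2.1.1 (h.lines_through r.1)
  have hpoints : Nat.card {r // (I r N ∧ r ≠ p) ∧ r ≠ q} = s :=
    Nat.card_subtype_and_ne ⟨hqN, hpq.symm⟩ (Nat.card_subtype_and_ne hpN (h.points_on N))
  have := Fintype.ofFinite {r // (I r N ∧ r ≠ p) ∧ r ≠ q}
  refine (Nat.card_eq_of_bijective F hF).symm.trans ?_
  rw [Nat.card_sigma, Finset.sum_congr rfl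
    fun r _ => hlines r, Finset.sum_const, Finset.card_univ, ← Nat.card_eq_fintype_card,
    hpoints, smul_eq_mul, mul_comm]

theorem ncount_five_six (h : IsGQ s (t + 1) P L I) {x y : GQFlag I} (hxy : Rrel I 5 x y) :
    Ncount I 5 6 x y = s * t := by
  have := h.finP
  have := h.finL
  obtain ⟨⟨⟨p, A⟩, hA⟩, ⟨⟨q, B⟩, hB⟩⟩ := x, y
  obtain ⟨hpq, N, hpN, hqN, hNA, hNB⟩ := hxy
  dsimp only at hA hB hpq hpN hqN hNA hNB
  have hpB : ¬ I p B := fun hp => hNB (h.unique_line p q hpq N B hpN hqN hp hB)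
  have not_collinear {u : P} {K : L} (hu : I u B) (huq : u ≠ q) (hpK : I p K) : ¬ I u K :=
    fun huK => huq (h.proj_unique_s4 hpB hpK huK hu hpN hqN hB).1
  have proj (w : {u // I u B ∧ u ≠ q} × {K // (I p K ∧ K ≠ A) ∧ K ≠ N}) :
      ∃ z : P × L, I w.1.1 z.2 ∧ I z.1 z.2 ∧ I z.1 w.2.1 :=
    (h.gq3 _ _ (not_collinear w.1.2.1 w.1.2.2 w.2.2.1.1)).exists
  choose f hu hf hK using proj
  have hfp w : p ≠ (f w).1 := fun e =>
    not_collinear w.1.2.1 w.1.2.2 (e ▸ hf w) (hu w)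
  have hfu w : w.1.1 ≠ (f w).1 := fun e =>
    not_collinear w.1.2.1 w.1.2.2 w.2.2.1.1 (e ▸ hK w)
  have hfB w : (f w).2 ≠ B := fun e =>
    w.2.2.2 (h.proj_unique_s4 hpB w.2.2.1.1 (hK w) (e ▸ hf w) hpN hqN hB).2
  let F : {u // I u B ∧ u ≠ q} × {K // (I p K ∧ K ≠ A) ∧ K ≠ N} →
      {z : GQFlag I // Rrel I 5 ⟨(p, A), hA⟩ z ∧ Rrel I 6 z ⟨(q, B), hB⟩} := fun w =>
    ⟨⟨f w, hf w⟩,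
      ⟨hfp w, w.2.1, w.2.2.1.1, hK w, w.2.2.1.2,
        fun e => not_collinear w.1.2.1 w.1.2.2 w.2.2.1.1 (e ▸ hu w)⟩,
      ⟨hfB w, w.1.1, hu w, w.1.2.1, hfu w, w.1.2.2⟩⟩
  have hF : Function.Bijective F := by
    constructor
    · intro v w he
      have he' : f v = f w := congrArg (fun z => z.1.1) he
      have h₁ : v.1.1 = w.1.1 := h.unique_point _ B (hfB v) _ _ (hu v) v.1.2.1
        (he' ▸ hu w) w.1.2.1
      have h₂ : v.2.1 = w.2.1 := h.unique_line p _ (hfp v) _ _ v.2.2.1.1 (hK v)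
        w.2.2.1.1 (he' ▸ hK w)
      exact Prod.ext (Subtype.ext h₁) (Subtype.ext h₂)
    · rintro ⟨⟨⟨r, C⟩, hC⟩, ⟨hpr, K, hpK, hrK, hKA, hKC⟩, ⟨hCB, u, huC, huB, hur, huq⟩⟩
      dsimp only at hC hpr hpK hrK hKA hKC hCB huC huB hur huq
      have hKN : K ≠ N := by
        rintro rfl
        by_cases hrq : r = q
        · subst hrq
          exact hur (h.unique_point C B hCB u r huC huB hC hB)
        · have hrB := h.incident_of_collinear huq huB hB huC hC hqN hrK
          exact hrq (h.unique_point K B hNB r q hrK hrB hqN hB)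
      let w : {u // I u B ∧ u ≠ q} × {K // (I p K ∧ K ≠ A) ∧ K ≠ N} :=
        (⟨u, huB, huq⟩, ⟨K, ⟨hpK, hKA⟩, hKN⟩)
      have hw := h.proj_unique_s4 (not_collinear huB huq hpK) (hu w) (hf w) (hK w) huC hC hrK
      exact ⟨w, Subtype.ext (Subtype.ext (Prod.ext hw.1 hw.2))⟩
  have hpoints : Nat.card {u // I u B ∧ u ≠ q} = s :=
    Nat.card_subtype_and_ne hB (h.points_on B)
  have hlines : Nat.card {K // (I p K ∧ K ≠ A) ∧ K ≠ N} = t :=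
    Nat.card_subtype_and_ne ⟨hpN, hNA⟩ (Nat.card_subtype_and_ne hA (h.lines_through p))
  refine (Nat.card_eq_of_bijective F hF).symm.trans ?_
  rw [Nat.card_prod, hpoints, hlines]

end IsGQ

/-- the intersection numbers `N_{55}` and `N_{56}` on pairs in `R_5`. -/
theorem stmt_4 {s t : ℕ} (hs : 1 ≤ s) (ht : 1 ≤ t)
    {P L : Type*} (I : P → L → Prop) (hGQ : IsGQ s t P L I) :
    ∀ x y : GQFlag I, Rrel I 5 x y →
      Ncount I 5 5 x y = t * (s - 1) ∧
      Ncount I 5 6 x y = s * (t - 1) := by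
  intro x y hxy
  obtain ⟨s, rfl⟩ := Nat.exists_eq_add_of_le' hs
  obtain ⟨t, rfl⟩ := Nat.exists_eq_add_of_le' ht
  exact ⟨hGQ.ncount_five_five hxy, hGQ.ncount_five_six hxy⟩
end

section
/- Let S be a finite generalized quadrangle of order (s,s) with s ≥ 1, Ω its set of flags, and S_0 = R_0, S_1 = R_1 ∪ R_2, S_2 = R_3 ∪ R_4, S_3 = R_5 ∪ R_6, S_4 = R_7. Then (Ω, {S_0,...,S_4}) is a symmetric association scheme of order (s+1)²(s²+1) and class 4: every S_l equals its own transpose, the S_l partition Ω × Ω, and for all i,j,k ∈ {0,...,4} and any two pairs (x,y), (x',y') ∈ S_k the number of z with (x,z) ∈ S_i and (z,y) ∈ S_j equals the number of z with (x',z) ∈ S_i and (z,y') ∈ S_j. Moreover the valencies are: for every x ∈ Ω, |{y : (x,y) ∈ S_1}| = 2s, |{y : (x,y) ∈ S_2}| = 2s², |{y : (x,y) ∈ S_3}| = 2s³, and |{y : (x,y) ∈ S_4}| = s⁴. -/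
section RelMatrix

open scoped Classical in
/-- The `0/1` matrix over `ℚ` of a binary relation. -/
noncomputable def relMatrix {α : Type*} (R : α → α → Prop) : Matrix α α ℚ :=
  Matrix.of fun x y => if R x y then 1 else 0

variable {α : Type*}

lemma relMatrix_of_rel {R : α → α → Prop} {x y : α} (h : R x y) : relMatrix R x y = 1 := by
  simp [relMatrix, h]

lemma relMatrix_of_not_rel {R : α → α → Prop} {x y : α} (h : ¬ R x y) :
    relMatrix R x y = 0 := by
  simp [relMatrix, h]

lemma relMatrix_or {R R' : α → α → Prop} (h : ∀ x y, R x y → ¬ R' x y) :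
    relMatrix (fun x y => R x y ∨ R' x y) = relMatrix R + relMatrix R' := by
  ext x y
  have := h x y
  by_cases h1 : R x y <;> by_cases h2 : R' x y <;> simp_all [relMatrix]

lemma relMatrix_eq [DecidableEq α] : relMatrix (fun x y : α => x = y) = 1 := by
  ext x y
  simp [relMatrix, Matrix.one_apply]

variable [Fintype α]

lemma relMatrix_mul_apply (R R' : α → α → Prop) (x y : α) :
    (relMatrix R * relMatrix R') x y = Nat.card {z // R x z ∧ R' z y} := by
  classical
  simp only [Matrix.mul_apply, relMatrix, Matrix.of_apply, ← ite_and, mul_ite, mul_one, mul_zero,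
    Nat.card_eq_fintype_card, Fintype.card_subtype, Finset.sum_boole]
  simp only [and_comm]

lemma relMatrix_mulVec_one (R : α → α → Prop) (x : α) :
    (relMatrix R).mulVec 1 x = Nat.card {y // R x y} := by
  classical
  simp [Matrix.mulVec, dotProduct, relMatrix, Fintype.card_subtype]

lemma relMatrix_mul_of_unique {R R' R'' : α → α → Prop}
    (hcomp : ∀ x z y, R x z → R' z y → R'' x y)
    (hex : ∀ x y, R'' x y → ∃ z, R x z ∧ R' z y)
    (huniq : ∀ x y z z', R x z → R' z y → R x z' → R' z' y → z = z') :
    relMatrix R * relMatrix R' = relMatrix R'' := by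
  ext x y
  rw [relMatrix_mul_apply]
  by_cases h : R'' x y
  · obtain ⟨z, hz⟩ := hex x y h
    have : Nat.card {z // R x z ∧ R' z y} = 1 :=
      Nat.card_eq_one_iff_exists.2 ⟨⟨z, hz⟩, fun w =>
        Subtype.ext (huniq x y _ _ w.2.1 w.2.2 hz.1 hz.2)⟩
    simp [this, relMatrix_of_rel h]
  · have : IsEmpty {z // R x z ∧ R' z y} := ⟨fun w => h (hcomp x _ y w.2.1 w.2.2)⟩
    simp [relMatrix_of_not_rel h]

/-- The relation "same fibre of `f`" satisfies `K² = n K` when all fibres have `n` elements. -/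
lemma relMatrix_fiber_mul_self {β : Type*} (f : α → β) (n : ℕ)
    (hn : ∀ x, Nat.card {z // f x = f z} = n) :
    relMatrix (fun x y => f x = f y) * relMatrix (fun x y => f x = f y) =
      (n : ℚ) • relMatrix (fun x y => f x = f y) := by
  ext x y
  rw [relMatrix_mul_apply, Matrix.smul_apply]
  by_cases h : f x = f y
  · rw [relMatrix_of_rel (R := fun x y => f x = f y) h, ← hn x]
    simp only [← h, eq_comm (b := f x), and_self, smul_eq_mul, mul_one]
  · have : IsEmpty {z // f x = f z ∧ f z = f y} := ⟨fun w => h (w.2.1.trans w.2.2)⟩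
    simp [relMatrix_of_not_rel (R := fun x y => f x = f y) h]

/-- A relation "same fibre of `f` but distinct", with fibres of `s + 1` elements, satisfies the
quadratic Hecke relation and has valency `s`. -/
lemma relMatrix_hecke [DecidableEq α] {β : Type*} {R : α → α → Prop} (f : α → β) (s : ℕ)
    (hR : ∀ x y, f x = f y ↔ x = y ∨ R x y) (hirr : ∀ x, ¬ R x x)
    (hn : ∀ x, Nat.card {z // f x = f z} = s + 1) :
    relMatrix R * relMatrix R = (s : ℚ) • 1 + ((s : ℚ) - 1) • relMatrix R ∧
      (relMatrix R).mulVec 1 = (s : ℚ) • 1 := by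
  have hK : relMatrix (fun x y => f x = f y) = 1 + relMatrix R := by
    simp only [hR]
    rw [relMatrix_or, relMatrix_eq]
    rintro x _ rfl
    exact hirr x
  constructor
  · have := relMatrix_fiber_mul_self f (s + 1) hn
    rw [hK] at this
    have h2 : relMatrix R * relMatrix R =
        (1 + relMatrix R) * (1 + relMatrix R) - (2 : ℚ) • relMatrix R - 1 := by
      rw [two_smul]; noncomm_ring
    rw [h2, this]
    push_cast
    module
  · have h1 : (relMatrix R).mulVec 1 =
        (relMatrix (fun x y => f x = f y)).mulVec 1 - (1 : α → ℚ) := by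
      rw [hK, Matrix.add_mulVec, Matrix.one_mulVec]; simp
    rw [h1]
    ext x
    rw [Pi.sub_apply, relMatrix_mulVec_one, hn]
    simp

end RelMatrix

@[ext]
lemma GQFlag.ext {P L : Type*} {I : P → L → Prop} {x y : GQFlag I} (h1 : x.1.1 = y.1.1)
    (h2 : x.1.2 = y.1.2) : x = y :=
  Subtype.ext (Prod.ext h1 h2)

namespace IsGQ

variable {P L : Type*} {I : P → L → Prop} {s t : ℕ}

lemma finite_flag (h : IsGQ s t P L I) : Finite (GQFlag I) := by
  have := h.finP
  have := h.finL
  exact Subtype.finite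

/-- A generalized quadrangle has no triangles. -/
lemma no_triangle (h : IsGQ s t P L I) {p q r : P} {l m n : L} (hpl : ¬ I p l)
    (hpm : I p m) (hqm : I q m) (hql : I q l) (hpn : I p n) (hrn : I r n) (hrl : I r l) :
    q = r ∧ m = n := by
  have := (h.gq3 p l hpl).unique (y₁ := (q, m)) (y₂ := (r, n)) ⟨hpm, hqm, hql⟩ ⟨hpn, hrn, hrl⟩
  simpa using this

lemma exists_proj (h : IsGQ s t P L I) {p : P} {l : L} (hpl : ¬ I p l) :
    ∃ q m, I p m ∧ I q m ∧ I q l := by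
  obtain ⟨⟨q, m⟩, h1, -⟩ := h.gq3 p l hpl
  exact ⟨q, m, h1⟩

lemma card_same_point (h : IsGQ s t P L I) (x : GQFlag I) :
    Nat.card {z : GQFlag I // x.1.1 = z.1.1} = t + 1 := by
  rw [← h.lines_through x.1.1]
  exact Nat.card_congr
    { toFun := fun z => ⟨z.1.1.2, (congrArg (I · z.1.1.2) z.2).mpr z.1.2⟩
      invFun := fun l => ⟨⟨(x.1.1, l.1), l.2⟩, rfl⟩
      left_inv := fun z => Subtype.ext (GQFlag.ext z.2 rfl)
      right_inv := fun l => rfl }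

lemma card_same_line (h : IsGQ s t P L I) (x : GQFlag I) :
    Nat.card {z : GQFlag I // x.1.2 = z.1.2} = s + 1 := by
  rw [← h.points_on x.1.2]
  exact Nat.card_congr
    { toFun := fun z => ⟨z.1.1.1, (congrArg (I z.1.1.1 ·) z.2).mpr z.1.2⟩
      invFun := fun p => ⟨⟨(p.1, x.1.2), p.2⟩, rfl⟩
      left_inv := fun z => Subtype.ext (GQFlag.ext rfl z.2)
      right_inv := fun p => rfl }

lemma hecke_point [Fintype (GQFlag I)] [DecidableEq (GQFlag I)] (h : IsGQ s t P L I) :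
    relMatrix (Rrel I 1) * relMatrix (Rrel I 1) =
        (t : ℚ) • 1 + ((t : ℚ) - 1) • relMatrix (Rrel I 1) ∧
      (relMatrix (Rrel I 1)).mulVec 1 = (t : ℚ) • 1 := by
  refine relMatrix_hecke (fun x : GQFlag I => x.1.1) t (fun x y => ?_) (fun x => ?_)
    h.card_same_point
  · rw [GQFlag.ext_iff]; simp only [Rrel]; tauto
  · simp [Rrel]

lemma hecke_line [Fintype (GQFlag I)] [DecidableEq (GQFlag I)] (h : IsGQ s t P L I) :
    relMatrix (Rrel I 2) * relMatrix (Rrel I 2) =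
        (s : ℚ) • 1 + ((s : ℚ) - 1) • relMatrix (Rrel I 2) ∧
      (relMatrix (Rrel I 2)).mulVec 1 = (s : ℚ) • 1 := by
  refine relMatrix_hecke (fun x : GQFlag I => x.1.2) s (fun x y => ?_) (fun x => ?_)
    h.card_same_line
  · rw [GQFlag.ext_iff]; simp only [Rrel]; tauto
  · simp [Rrel]

/-- If `p` lies on `l` and `n ≠ l`, and `r ≠ p, q` lies on `n` and `m ∋ q`, then the flags
`(p, l)` and `(q, m)` are opposite. -/
lemma opposite_of_path (h : IsGQ s t P L I) {p q r : P} {l m n : L} (hpl : I p l) (hqm : I q m)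
    (hpn : I p n) (hrn : I r n) (hrm : I r m) (hln : l ≠ n) (hnm : n ≠ m) (hrp : r ≠ p)
    (hrq : r ≠ q) : (∀ u, ¬ (I u l ∧ I u m)) ∧ ¬ Collin I p q := by
  have hpm : ¬ I p m := fun hpm => hnm (h.unique_line _ _ hrp _ _ hrn hpn hrm hpm)
  constructor
  · rintro u ⟨hul, hum⟩
    exact hln (h.no_triangle hpm hpl hul hum hpn hrn hrm).2
  · rintro ⟨-, k, hpk, hqk⟩
    exact hrq (h.no_triangle hpm hpk hqk hqm hpn hrn hrm).1.symm

lemma exists_path_of_opposite (h : IsGQ s t P L I) {p q : P} {l m : L} (hpl : I p l)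
    (hqm : I q m) (hlm : ∀ u, ¬ (I u l ∧ I u m)) (hpq : ¬ Collin I p q) :
    ∃ r n, I p n ∧ I r n ∧ I r m ∧ l ≠ n ∧ n ≠ m ∧ r ≠ p ∧ r ≠ q := by
  have hpm : ¬ I p m := fun hpm => hlm p ⟨hpl, hpm⟩
  obtain ⟨r, n, hpn, hrn, hrm⟩ := h.exists_proj hpm
  refine ⟨r, n, hpn, hrn, hrm, ?_, ?_, ?_, ?_⟩
  · rintro rfl; exact hlm r ⟨hrn, hrm⟩
  · rintro rfl; exact hpm hpn
  · rintro rfl; exact hpm hrm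
  · rintro rfl
    exact hpq ⟨fun e => hpm (e ▸ hrm), n, hpn, hrn⟩

lemma rrel_seven_symm {x y : GQFlag I} (h : Rrel I 7 x y) : Rrel I 7 y x :=
  ⟨fun r hr => h.1 r hr.symm, fun ⟨hne, n, h1, h2⟩ => h.2 ⟨hne.symm, n, h2, h1⟩⟩

section Products

variable [Fintype (GQFlag I)]

lemma mul_one_two : relMatrix (Rrel I 1) * relMatrix (Rrel I 2) = relMatrix (Rrel I 4) := by
  apply relMatrix_mul_of_unique
  · rintro ⟨⟨p, l⟩, hx⟩ ⟨⟨r, n⟩, hz⟩ ⟨⟨q, m⟩, hy⟩ h1 h2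
    simp only [Rrel] at *
    grind
  · rintro ⟨⟨p, l⟩, hx⟩ ⟨⟨q, m⟩, hy⟩ h1
    simp only [Rrel] at *
    exact ⟨⟨(p, m), h1.2.2⟩, ⟨rfl, h1.2.1⟩, rfl, h1.1⟩
  · intro x y z z' h1 h2 h3 h4
    exact GQFlag.ext (h1.1.symm.trans h3.1) (h2.1.trans h4.1.symm)

lemma mul_two_one : relMatrix (Rrel I 2) * relMatrix (Rrel I 1) = relMatrix (Rrel I 3) := by
  apply relMatrix_mul_of_unique
  · rintro ⟨⟨p, l⟩, hx⟩ ⟨⟨r, n⟩, hz⟩ ⟨⟨q, m⟩, hy⟩ h1 h2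
    simp only [Rrel] at *
    grind
  · rintro ⟨⟨p, l⟩, hx⟩ ⟨⟨q, m⟩, hy⟩ h1
    simp only [Rrel] at *
    exact ⟨⟨(q, l), h1.2.2⟩, ⟨rfl, h1.1⟩, rfl, h1.2.1⟩
  · intro x y z z' h1 h2 h3 h4
    exact GQFlag.ext (h2.1.trans h4.1.symm) (h1.1.symm.trans h3.1)

lemma mul_one_three (h : IsGQ s t P L I) :
    relMatrix (Rrel I 1) * relMatrix (Rrel I 3) = relMatrix (Rrel I 5) := by
  apply relMatrix_mul_of_unique
  · rintro ⟨⟨p, l⟩, hx⟩ ⟨⟨r, n⟩, hz⟩ ⟨⟨q, m⟩, hy⟩ h1 h2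
    simp only [Rrel] at *
    exact ⟨h1.1 ▸ h2.1, n, h1.1 ▸ hz, h2.2.2, h1.2.symm, h2.2.1⟩
  · rintro ⟨⟨p, l⟩, hx⟩ ⟨⟨q, m⟩, hy⟩ ⟨h1, n, h2, h3, h4, h5⟩
    exact ⟨⟨(p, n), h2⟩, ⟨rfl, h4.symm⟩, h1, h5, h3⟩
  · rintro ⟨⟨p, l⟩, hx⟩ ⟨⟨q, m⟩, hy⟩ ⟨⟨r, n⟩, hz⟩ ⟨⟨r', n'⟩, hz'⟩ h1 h2 h3 h4
    simp only [Rrel] at *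
    obtain ⟨rfl, h1⟩ := h1
    obtain ⟨rfl, h3⟩ := h3
    exact GQFlag.ext rfl (h.unique_line _ _ h2.1 _ _ hz h2.2.2 hz' h4.2.2)

lemma mul_two_four (h : IsGQ s t P L I) :
    relMatrix (Rrel I 2) * relMatrix (Rrel I 4) = relMatrix (Rrel I 6) := by
  apply relMatrix_mul_of_unique
  · rintro ⟨⟨p, l⟩, hx⟩ ⟨⟨r, n⟩, hz⟩ ⟨⟨q, m⟩, hy⟩ h1 h2
    simp only [Rrel] at *
    exact ⟨h1.1 ▸ h2.2.1, r, h1.1 ▸ hz, h2.2.2, h1.2.symm, h2.1⟩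
  · rintro ⟨⟨p, l⟩, hx⟩ ⟨⟨q, m⟩, hy⟩ ⟨h1, r, h2, h3, h4, h5⟩
    exact ⟨⟨(r, l), h2⟩, ⟨rfl, h4.symm⟩, h5, h1, h3⟩
  · rintro ⟨⟨p, l⟩, hx⟩ ⟨⟨q, m⟩, hy⟩ ⟨⟨r, n⟩, hz⟩ ⟨⟨r', n'⟩, hz'⟩ h1 h2 h3 h4
    simp only [Rrel] at *
    obtain ⟨rfl, h1⟩ := h1
    obtain ⟨rfl, h3⟩ := h3
    exact GQFlag.ext (h.unique_point _ _ h2.2.1 _ _ hz h2.2.2 hz' h4.2.2) rfl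

lemma mul_one_six (h : IsGQ s t P L I) :
    relMatrix (Rrel I 1) * relMatrix (Rrel I 6) = relMatrix (Rrel I 7) := by
  apply relMatrix_mul_of_unique
  · rintro ⟨⟨p, l⟩, hx⟩ ⟨⟨_, n⟩, hz⟩ ⟨⟨q, m⟩, hy⟩ ⟨h1, h2⟩ ⟨h3, r, h4, h5, h6, h7⟩
    simp only at *
    subst h1
    exact h.opposite_of_path hx hy hz h4 h5 h2 h3 h6 h7
  · rintro ⟨⟨p, l⟩, hx⟩ ⟨⟨q, m⟩, hy⟩ ⟨h1, h2⟩
    obtain ⟨r, n, h3, h4, h5, h6, h7, h8, h9⟩ := h.exists_path_of_opposite hx hy h1 h2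
    exact ⟨⟨(p, n), h3⟩, ⟨rfl, h6⟩, h7, r, h4, h5, h8, h9⟩
  · rintro ⟨⟨p, l⟩, hx⟩ ⟨⟨q, m⟩, hy⟩ ⟨⟨_, n⟩, hz⟩ ⟨⟨_, n'⟩, hz'⟩ ⟨h1, h2⟩
      ⟨h3, r, h4, h5, h6, h7⟩ ⟨h1', h2'⟩ ⟨h3', r', h4', h5', h6', h7'⟩
    simp only at *
    subst h1 h1'
    have hpm : ¬ I p m := fun hpm => h3 (h.unique_line _ _ h6 _ _ h4 hz h5 hpm)
    exact GQFlag.ext rfl (h.no_triangle hpm hz h4 h5 hz' h4' h5').2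

lemma mul_two_five (h : IsGQ s t P L I) :
    relMatrix (Rrel I 2) * relMatrix (Rrel I 5) = relMatrix (Rrel I 7) := by
  apply relMatrix_mul_of_unique
  · rintro ⟨⟨p, l⟩, hx⟩ ⟨⟨r, _⟩, hz⟩ ⟨⟨q, m⟩, hy⟩ ⟨h1, h2⟩ ⟨h3, n, h4, h5, h6, h7⟩
    simp only at *
    subst h1
    exact rrel_seven_symm (x := ⟨(q, m), hy⟩) (y := ⟨(p, l), hx⟩)
      (h.opposite_of_path hy hx h5 h4 hz h7.symm h6 h3 h2.symm)
  · rintro ⟨⟨p, l⟩, hx⟩ ⟨⟨q, m⟩, hy⟩ h12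
    obtain ⟨h1, h2⟩ := rrel_seven_symm h12
    obtain ⟨r, n, h3, h4, h5, h6, h7, h8, h9⟩ := h.exists_path_of_opposite hy hx h1 h2
    exact ⟨⟨(r, l), h5⟩, ⟨rfl, h9.symm⟩, h8, n, h4, h3, h7, h6.symm⟩
  · rintro ⟨⟨p, l⟩, hx⟩ ⟨⟨q, m⟩, hy⟩ ⟨⟨r, _⟩, hz⟩ ⟨⟨r', _⟩, hz'⟩ ⟨h1, h2⟩
      ⟨h3, n, h4, h5, h6, h7⟩ ⟨h1', h2'⟩ ⟨h3', n', h4', h5', h6', h7'⟩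
    simp only at *
    subst h1 h1'
    have hql : ¬ I q l := fun hql => h6 (h.unique_line _ _ h3 _ _ h4 h5 hz hql)
    exact GQFlag.ext (h.no_triangle hql h5 h4 hz h5' h4' hz').1 rfl

end Products

lemma srel_symm {l : ℕ} {x y : GQFlag I} (h : Srel I l x y) : Srel I l y x := by
  match l, h with
  | 0, h => exact Eq.symm h
  | 1, h => exact h.imp (fun h => ⟨h.1.symm, h.2.symm⟩) (fun h => ⟨h.1.symm, h.2.symm⟩)
  | 2, h =>
    exact h.symm.imp (fun h => ⟨h.1.symm, h.2.1.symm, h.2.2⟩)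
      (fun h => ⟨h.1.symm, h.2.1.symm, h.2.2⟩)
  | 3, h =>
    exact h.imp (fun ⟨h, n, h1, h2, h3, h4⟩ => ⟨h.symm, n, h2, h1, h4, h3⟩)
      (fun ⟨h, n, h1, h2, h3, h4⟩ => ⟨h.symm, n, h2, h1, h4, h3⟩)
  | 4, h => exact rrel_seven_symm h

lemma rrel_five_not_meet (h : IsGQ s t P L I) {x y : GQFlag I} (h5 : Rrel I 5 x y) (r : P) :
    ¬ (I r x.1.2 ∧ I r y.1.2) := by
  obtain ⟨⟨p, l⟩, hx⟩ := x
  obtain ⟨⟨q, m⟩, hy⟩ := y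
  obtain ⟨h1, n, h2, h3, h4, h5⟩ := h5
  rintro ⟨h6, h7⟩
  simp only at *
  have hpm : ¬ I p m := fun hpm => h5 (h.unique_line _ _ h1 _ _ h2 h3 hpm hy)
  exact h4 (h.no_triangle hpm h2 h3 hy hx h6 h7).2

lemma exists_srel (x y : GQFlag I) : ∃ l < 5, Srel I l x y := by
  obtain ⟨⟨p, l⟩, hx⟩ := x
  obtain ⟨⟨q, m⟩, hy⟩ := y
  simp only at hx hy
  by_cases h0 : p = q
  · by_cases h1 : l = m
    · exact ⟨0, by simp, GQFlag.ext h0 h1⟩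
    · exact ⟨1, by simp, Or.inl ⟨h0, h1⟩⟩
  by_cases h1 : l = m
  · exact ⟨1, by simp, Or.inr ⟨h1, h0⟩⟩
  by_cases h2 : I q l
  · exact ⟨2, by simp, Or.inl ⟨h0, h1, h2⟩⟩
  by_cases h3 : I p m
  · exact ⟨2, by simp, Or.inr ⟨h0, h1, h3⟩⟩
  by_cases h4 : ∃ r, I r l ∧ I r m
  · obtain ⟨r, h5, h6⟩ := h4
    refine ⟨3, by simp, Or.inr ⟨h1, r, h5, h6, ?_, ?_⟩⟩
    · rintro rfl; exact h3 h6
    · rintro rfl; exact h2 h5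
  by_cases h5 : Collin I p q
  · obtain ⟨-, n, h6, h7⟩ := h5
    refine ⟨3, by simp, Or.inl ⟨h0, n, h6, h7, ?_, ?_⟩⟩
    · rintro rfl; exact h2 h7
    · rintro rfl; exact h3 h6
  exact ⟨4, by simp, not_exists.1 h4, h5⟩

lemma srel_unique (h : IsGQ s t P L I) {x y : GQFlag I} {i j : ℕ}
    (hi : Srel I i x y) (hj : Srel I j x y) : i = j := by
  have key : ∀ i j, i < j → Srel I i x y → Srel I j x y → False := by
    clear hi hj i j
    have h5 : Rrel I 5 x y → ∀ r, ¬ (I r x.1.2 ∧ I r y.1.2) := h.rrel_five_not_meet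
    have hl := h.unique_line
    have hp := h.unique_point
    obtain ⟨⟨p, l⟩, hx⟩ := x
    obtain ⟨⟨q, m⟩, hy⟩ := y
    intro i j hij hi hj
    match i, j with
    | 0, 1 | 0, 2 | 0, 3 | 0, 4 | 1, 2 | 1, 3 | 1, 4 | 2, 3 | 2, 4 | 3, 4 =>
      simp only [Srel, Rrel, Collin] at *
      grind
    | i, j + 5 => exact hj
    | i + 5, _ => exact hi
    | 4, 4 => omega
  rcases lt_trichotomy i j with hij | hij | hij
  · exact (key i j hij hi hj).elim
  · exact hij
  · exact (key j i hij hj hi).elim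

section Fusion

lemma relMatrix_srel_zero [DecidableEq (GQFlag I)] : relMatrix (Srel I 0) = 1 := relMatrix_eq

lemma relMatrix_srel_one :
    relMatrix (Srel I 1) = relMatrix (Rrel I 1) + relMatrix (Rrel I 2) :=
  relMatrix_or fun _ _ h h' => h'.2 h.1

lemma relMatrix_srel_two (h : IsGQ s t P L I) :
    relMatrix (Srel I 2) = relMatrix (Rrel I 3) + relMatrix (Rrel I 4) :=
  relMatrix_or fun x y h3 h4 =>
    h3.2.1 (h.unique_line _ _ h3.1 _ _ x.2 h3.2.2 h4.2.2 y.2)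

lemma relMatrix_srel_three (h : IsGQ s t P L I) :
    relMatrix (Srel I 3) = relMatrix (Rrel I 5) + relMatrix (Rrel I 6) :=
  relMatrix_or fun _ _ h5 ⟨_, r, h1, h2, _⟩ => h.rrel_five_not_meet h5 r ⟨h1, h2⟩

/-- The span of the matrices of the fused relations. -/
noncomputable def fusionSpan (I : P → L → Prop) : Submodule ℚ (Matrix (GQFlag I) (GQFlag I) ℚ) :=
  Submodule.span ℚ (Set.range fun k : Fin 5 => relMatrix (Srel I k))

lemma relMatrix_mem_fusionSpan {k : ℕ} (hk : k < 5) : relMatrix (Srel I k) ∈ fusionSpan I :=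
  Submodule.subset_span ⟨⟨k, hk⟩, rfl⟩

/-- Matrices in the span of the fused relations are constant on each fused relation. -/
lemma apply_eq_of_mem_fusionSpan (h : IsGQ s t P L I) {M : Matrix (GQFlag I) (GQFlag I) ℚ}
    (hM : M ∈ fusionSpan I) {k : ℕ} {x y x' y' : GQFlag I} (hxy : Srel I k x y)
    (hxy' : Srel I k x' y') : M x y = M x' y' := by
  induction hM using Submodule.span_induction with
  | mem M hM =>
    obtain ⟨i, rfl⟩ := hM
    by_cases hik : (i : ℕ) = k
    · subst hik
      exact (relMatrix_of_rel hxy).trans (relMatrix_of_rel hxy').symm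
    · exact (relMatrix_of_not_rel fun hi => hik (h.srel_unique hi hxy)).trans
        (relMatrix_of_not_rel fun hi => hik (h.srel_unique hi hxy')).symm
  | zero => rfl
  | add M N _ _ hM hN => rw [Matrix.add_apply, Matrix.add_apply, hM, hN]
  | smul c M _ hM => rw [Matrix.smul_apply, Matrix.smul_apply, hM]

variable [Fintype (GQFlag I)] [DecidableEq (GQFlag I)]

/-- Left multiplication by the generator `R_1` on the matrices of the flag relations. -/
lemma point_mul (h : IsGQ s s P L I) :
    relMatrix (Rrel I 1) * relMatrix (Rrel I 4) =
        (s : ℚ) • relMatrix (Rrel I 2) + ((s : ℚ) - 1) • relMatrix (Rrel I 4) ∧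
      relMatrix (Rrel I 1) * relMatrix (Rrel I 5) =
        (s : ℚ) • relMatrix (Rrel I 3) + ((s : ℚ) - 1) • relMatrix (Rrel I 5) ∧
      relMatrix (Rrel I 1) * relMatrix (Rrel I 7) =
        (s : ℚ) • relMatrix (Rrel I 6) + ((s : ℚ) - 1) • relMatrix (Rrel I 7) := by
  refine ⟨?_, ?_, ?_⟩
  · rw [← mul_one_two, ← mul_assoc, h.hecke_point.1, add_mul, smul_mul_assoc, smul_mul_assoc,
      one_mul]
  · rw [← h.mul_one_three, ← mul_assoc, h.hecke_point.1, add_mul, smul_mul_assoc, smul_mul_assoc,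
      one_mul]
  · rw [← h.mul_one_six, ← mul_assoc, h.hecke_point.1, add_mul, smul_mul_assoc, smul_mul_assoc,
      one_mul]

/-- Left multiplication by the generator `R_2` on the matrices of the flag relations. -/
lemma line_mul (h : IsGQ s s P L I) :
    relMatrix (Rrel I 2) * relMatrix (Rrel I 3) =
        (s : ℚ) • relMatrix (Rrel I 1) + ((s : ℚ) - 1) • relMatrix (Rrel I 3) ∧
      relMatrix (Rrel I 2) * relMatrix (Rrel I 6) =
        (s : ℚ) • relMatrix (Rrel I 4) + ((s : ℚ) - 1) • relMatrix (Rrel I 6) ∧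
      relMatrix (Rrel I 2) * relMatrix (Rrel I 7) =
        (s : ℚ) • relMatrix (Rrel I 5) + ((s : ℚ) - 1) • relMatrix (Rrel I 7) := by
  refine ⟨?_, ?_, ?_⟩
  · rw [← mul_two_one, ← mul_assoc, h.hecke_line.1, add_mul, smul_mul_assoc, smul_mul_assoc,
      one_mul]
  · rw [← h.mul_two_four, ← mul_assoc, h.hecke_line.1, add_mul, smul_mul_assoc, smul_mul_assoc,
      one_mul]
  · rw [← h.mul_two_five, ← mul_assoc, h.hecke_line.1, add_mul, smul_mul_assoc, smul_mul_assoc,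
      one_mul]

lemma srel_one_mul_one (h : IsGQ s s P L I) :
    relMatrix (Srel I 1) * relMatrix (Srel I 1) =
      (2 * s : ℚ) • relMatrix (Srel I 0) + ((s : ℚ) - 1) • relMatrix (Srel I 1) +
        relMatrix (Srel I 2) := by
  rw [relMatrix_srel_zero, relMatrix_srel_one, h.relMatrix_srel_two, add_mul, mul_add, mul_add,
    h.hecke_point.1, h.hecke_line.1, mul_one_two, mul_two_one]
  module

lemma srel_one_mul_two (h : IsGQ s s P L I) :
    relMatrix (Srel I 1) * relMatrix (Srel I 2) =
      (s : ℚ) • relMatrix (Srel I 1) + ((s : ℚ) - 1) • relMatrix (Srel I 2) +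
        relMatrix (Srel I 3) := by
  rw [relMatrix_srel_one, h.relMatrix_srel_two, h.relMatrix_srel_three, add_mul, mul_add, mul_add,
    h.point_mul.1, h.line_mul.1, h.mul_one_three, h.mul_two_four]
  module

lemma srel_one_mul_three (h : IsGQ s s P L I) :
    relMatrix (Srel I 1) * relMatrix (Srel I 3) =
      (s : ℚ) • relMatrix (Srel I 2) + ((s : ℚ) - 1) • relMatrix (Srel I 3) +
        (2 : ℚ) • relMatrix (Srel I 4) := by
  rw [relMatrix_srel_one, h.relMatrix_srel_two, h.relMatrix_srel_three, add_mul, mul_add, mul_add,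
    h.point_mul.2.1, h.line_mul.2.1, h.mul_one_six, h.mul_two_five]
  simp only [Srel]
  module

lemma srel_one_mul_four (h : IsGQ s s P L I) :
    relMatrix (Srel I 1) * relMatrix (Srel I 4) =
      (s : ℚ) • relMatrix (Srel I 3) + (2 * ((s : ℚ) - 1)) • relMatrix (Srel I 4) := by
  have h1 := h.point_mul.2.2
  have h2 := h.line_mul.2.2
  rw [relMatrix_srel_one, h.relMatrix_srel_three, add_mul]
  simp only [Srel]
  rw [h1, h2]
  module

lemma srel_one_mul_mem (h : IsGQ s s P L I) {M : Matrix (GQFlag I) (GQFlag I) ℚ}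
    (hM : M ∈ fusionSpan I) : relMatrix (Srel I 1) * M ∈ fusionSpan I := by
  have hm {k : ℕ} (hk : k < 5) (c : ℚ) : c • relMatrix (Srel I k) ∈ fusionSpan I :=
    Submodule.smul_mem _ _ (relMatrix_mem_fusionSpan hk)
  induction hM using Submodule.span_induction with
  | mem M hM =>
    obtain ⟨k, rfl⟩ := hM
    fin_cases k
    · simpa [relMatrix_srel_zero] using relMatrix_mem_fusionSpan (I := I) (k := 1) (by simp)
    · exact h.srel_one_mul_one ▸ add_mem (add_mem (hm (by simp) _) (hm (by simp) _))
        (relMatrix_mem_fusionSpan (by simp))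
    · exact h.srel_one_mul_two ▸ add_mem (add_mem (hm (by simp) _) (hm (by simp) _))
        (relMatrix_mem_fusionSpan (by simp))
    · exact h.srel_one_mul_three ▸ add_mem (add_mem (hm (by simp) _) (hm (by simp) _))
        (hm (by simp) _)
    · exact h.srel_one_mul_four ▸ add_mem (hm (by simp) _) (hm (by simp) _)
  | zero => simp
  | add M N _ _ hM hN => rw [mul_add]; exact add_mem hM hN
  | smul c M _ hM => rw [mul_smul_comm]; exact Submodule.smul_mem _ _ hM

lemma srel_mul_mem (h : IsGQ s s P L I) {k : ℕ} (hk : k < 5)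
    {M : Matrix (GQFlag I) (GQFlag I) ℚ} (hM : M ∈ fusionSpan I) :
    relMatrix (Srel I k) * M ∈ fusionSpan I := by
  have hsm {N : Matrix (GQFlag I) (GQFlag I) ℚ} (c : ℚ) (hN : N ∈ fusionSpan I) :
      c • N ∈ fusionSpan I := Submodule.smul_mem _ _ hN
  have h0 : relMatrix (Srel I 0) * M ∈ fusionSpan I := by
    rwa [relMatrix_srel_zero, one_mul]
  have h1 := h.srel_one_mul_mem hM
  have h2 : relMatrix (Srel I 2) * M ∈ fusionSpan I := by
    have e := congrArg (· * M) h.srel_one_mul_one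
    simp only [add_mul, smul_mul_assoc, mul_assoc] at e
    rw [eq_sub_of_add_eq' e.symm]
    exact sub_mem (h.srel_one_mul_mem h1) (add_mem (hsm _ h0) (hsm _ h1))
  have h3 : relMatrix (Srel I 3) * M ∈ fusionSpan I := by
    have e := congrArg (· * M) h.srel_one_mul_two
    simp only [add_mul, smul_mul_assoc, mul_assoc] at e
    rw [eq_sub_of_add_eq' e.symm]
    exact sub_mem (h.srel_one_mul_mem h2) (add_mem (hsm _ h1) (hsm _ h2))
  have h4 : relMatrix (Srel I 4) * M ∈ fusionSpan I := by
    have e := congrArg (· * M) h.srel_one_mul_three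
    simp only [add_mul, smul_mul_assoc, mul_assoc] at e
    rw [← Submodule.smul_mem_iff (s := (2 : ℚ)) _ two_ne_zero, eq_sub_of_add_eq' e.symm]
    exact sub_mem (h.srel_one_mul_mem h3) (add_mem (hsm _ h2) (hsm _ h3))
  interval_cases k <;> assumption

lemma rrel_valencies (h : IsGQ s s P L I) :
    (relMatrix (Rrel I 3)).mulVec 1 = (s : ℚ) ^ 2 • 1 ∧
      (relMatrix (Rrel I 4)).mulVec 1 = (s : ℚ) ^ 2 • 1 ∧
      (relMatrix (Rrel I 5)).mulVec 1 = (s : ℚ) ^ 3 • 1 ∧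
      (relMatrix (Rrel I 6)).mulVec 1 = (s : ℚ) ^ 3 • 1 ∧
      (relMatrix (Rrel I 7)).mulVec 1 = (s : ℚ) ^ 4 • 1 := by
  have h1 := h.hecke_point.2
  have h2 := h.hecke_line.2
  have h3 : (relMatrix (Rrel I 3)).mulVec 1 = (s : ℚ) ^ 2 • 1 := by
    rw [← mul_two_one, ← Matrix.mulVec_mulVec, h1, Matrix.mulVec_smul, h2]; module
  have h4 : (relMatrix (Rrel I 4)).mulVec 1 = (s : ℚ) ^ 2 • 1 := by
    rw [← mul_one_two, ← Matrix.mulVec_mulVec, h2, Matrix.mulVec_smul, h1]; module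
  have h5 : (relMatrix (Rrel I 5)).mulVec 1 = (s : ℚ) ^ 3 • 1 := by
    rw [← h.mul_one_three, ← Matrix.mulVec_mulVec, h3, Matrix.mulVec_smul, h1]; module
  have h6 : (relMatrix (Rrel I 6)).mulVec 1 = (s : ℚ) ^ 3 • 1 := by
    rw [← h.mul_two_four, ← Matrix.mulVec_mulVec, h4, Matrix.mulVec_smul, h2]; module
  refine ⟨h3, h4, h5, h6, ?_⟩
  rw [← h.mul_one_six, ← Matrix.mulVec_mulVec, h6, Matrix.mulVec_smul, h1]; module

end Fusion

lemma srel_valencies (h : IsGQ s s P L I) (x : GQFlag I) :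
    Nat.card {y : GQFlag I // Srel I 1 x y} = 2 * s ∧
      Nat.card {y : GQFlag I // Srel I 2 x y} = 2 * s ^ 2 ∧
      Nat.card {y : GQFlag I // Srel I 3 x y} = 2 * s ^ 3 ∧
      Nat.card {y : GQFlag I // Srel I 4 x y} = s ^ 4 := by
  classical
  have := h.finite_flag
  have := Fintype.ofFinite (GQFlag I)
  obtain ⟨h3, h4, h5, h6, h7⟩ := h.rrel_valencies
  refine ⟨?_, ?_, ?_, ?_⟩ <;> apply Nat.cast_injective (R := ℚ) <;> rw [← relMatrix_mulVec_one]
  · rw [relMatrix_srel_one, Matrix.add_mulVec, h.hecke_point.2, h.hecke_line.2]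
    simp [two_mul]
  · rw [h.relMatrix_srel_two, Matrix.add_mulVec, h3, h4]
    simp [two_mul]
  · rw [h.relMatrix_srel_three, Matrix.add_mulVec, h5, h6]
    simp [two_mul]
  · simp only [Srel]
    rw [h7]
    simp

lemma nonempty_flag (h : IsGQ s t P L I) : Nonempty (GQFlag I) := by
  obtain ⟨p⟩ := h.nonemptyP
  have : Nat.card {l : L // I p l} ≠ 0 := by rw [h.lines_through]; simp
  obtain ⟨l, hl⟩ := (Nat.card_ne_zero.1 this).1
  exact ⟨⟨(p, l), hl⟩⟩

lemma card_flag (h : IsGQ s s P L I) :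
    Nat.card (GQFlag I) = (s + 1) ^ 2 * (s ^ 2 + 1) := by
  classical
  have := h.finite_flag
  have := Fintype.ofFinite (GQFlag I)
  obtain ⟨x⟩ := h.nonempty_flag
  choose f hf hfx using exists_srel x
  have hiff (k : Fin 5) (y : GQFlag I) : (⟨f y, hf y⟩ : Fin 5) = k ↔ Srel I k x y := by
    rw [Fin.ext_iff]
    refine ⟨fun e => ?_, h.srel_unique (hfx y)⟩
    simp only at e
    exact e ▸ hfx y
  have hcard : Nat.card (GQFlag I) = ∑ k : Fin 5, Nat.card {y // Srel I k x y} := by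
    rw [← Nat.card_sigma, ← Nat.card_congr (Equiv.sigmaFiberEquiv fun y => (⟨f y, hf y⟩ : Fin 5))]
    simp only [hiff]
  obtain ⟨h1, h2, h3, h4⟩ := h.srel_valencies x
  have h0 : Nat.card {y // Srel I 0 x y} = 1 := by
    simp only [Srel, Rrel]
    simp
  rw [hcard]
  simp only [Fin.sum_univ_five]
  have e : Nat.card {y // Srel I 0 x y} + Nat.card {y // Srel I 1 x y} +
      Nat.card {y // Srel I 2 x y} + Nat.card {y // Srel I 3 x y} +
      Nat.card {y // Srel I 4 x y} = (s + 1) ^ 2 * (s ^ 2 + 1) := by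
    rw [h0, h1, h2, h3, h4]; ring
  exact e

lemma mcount_eq (h : IsGQ s s P L I) {i j k : ℕ} (hi : i < 5) (hj : j < 5)
    {x y x' y' : GQFlag I} (hxy : Srel I k x y) (hxy' : Srel I k x' y') :
    Mcount I i j x y = Mcount I i j x' y' := by
  classical
  have := h.finite_flag
  have := Fintype.ofFinite (GQFlag I)
  apply Nat.cast_injective (R := ℚ)
  rw [Mcount, Mcount, ← relMatrix_mul_apply, ← relMatrix_mul_apply]
  exact h.apply_eq_of_mem_fusionSpan (h.srel_mul_mem hi (relMatrix_mem_fusionSpan hj)) hxy hxy'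

end IsGQ

/-- the fusion `(Ω, {S_0,…,S_4})` of the flag scheme of a GQ of
order `(s,s)` is a symmetric association scheme of order `(s+1)²(s²+1)` and
class 4, with valencies `2s, 2s², 2s³, s⁴`. -/
theorem stmt_13 {s : ℕ} (hs : 1 ≤ s)
    {P L : Type*} (I : P → L → Prop) (hGQ : IsGQ s s P L I) :
    Nat.card (GQFlag I) = (s + 1) ^ 2 * (s ^ 2 + 1) ∧
    (∀ l : ℕ, l < 5 → ∀ x y : GQFlag I, Srel I l x y ↔ Srel I l y x) ∧
    (∀ x y : GQFlag I, ∃! l : ℕ, l < 5 ∧ Srel I l x y) ∧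
    (∀ i j k : ℕ, i < 5 → j < 5 → k < 5 → ∀ x y x' y' : GQFlag I,
      Srel I k x y → Srel I k x' y' → Mcount I i j x y = Mcount I i j x' y') ∧
    (∀ x : GQFlag I,
      Nat.card {y : GQFlag I // Srel I 1 x y} = 2 * s ∧
      Nat.card {y : GQFlag I // Srel I 2 x y} = 2 * s ^ 2 ∧
      Nat.card {y : GQFlag I // Srel I 3 x y} = 2 * s ^ 3 ∧
      Nat.card {y : GQFlag I // Srel I 4 x y} = s ^ 4) := by
  refine ⟨hGQ.card_flag, fun l _ x y => ⟨IsGQ.srel_symm, IsGQ.srel_symm⟩, fun x y => ?_,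
    fun i j k hi hj _ x y x' y' h h' => hGQ.mcount_eq hi hj h h', hGQ.srel_valencies⟩
  obtain ⟨l, hl, hxy⟩ := IsGQ.exists_srel x y
  exact ⟨l, ⟨hl, hxy⟩, fun k hk => hGQ.srel_unique hk.2 hxy⟩
end
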